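/- Let p⁻, r⁺, s⁻, s⁺, β⁻, β⁺ be real numbers with 1 < p⁻ ≤ r⁺ < s⁻ ≤ s⁺ and 0 < β⁻ ≤ β⁺ < 1. Assume (s⁺ − p⁻)(1 − β⁻) < p⁻(s⁻ − r⁺) and s⁻ + β⁺ ≤ s⁺ + β⁻. Then (1/p⁻ − 1/s⁺) + (1/s⁺ − 1/(1 − β⁻))·(s⁻ − r⁺)/(s⁻ − (1 − β⁺)) < 0. -/

import Mathlib

theorem stmt_7 (pm rp sm sp bm bp : ℝ) (h1 : 1 < pm) (h2 : pm ≤ rp) (h3 : rp < sm)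
    (h4 : sm ≤ sp) (h5 : 0 < bm) (h6 : bm ≤ bp) (h7 : bp < 1)
    (h8 : (sp - pm) * (1 - bm) < pm * (sm - rp)) (h9 : sm + bp ≤ sp + bm) :
    (1 / pm - 1 / sp) + (1 / sp - 1 / (1 - bm)) * ((sm - rp) / (sm - (1 - bp))) < 0 := by
  have hp : 0 < pm := by linarith
  have hs : 0 < sp := by linarith
  have hb : 0 < 1 - bm := by linarith
  have hD : 0 < sm - (1 - bp) := by linarith
  have key : (1 / pm - 1 / sp) + (1 / sp - 1 / (1 - bm)) * ((sm - rp) / (sm - (1 - bp)))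
      = ((sp - pm) * (1 - bm) * (sm - (1 - bp)) - pm * (sm - rp) * (sp - (1 - bm)))
        / (pm * sp * (1 - bm) * (sm - (1 - bp))) := by
    have a := hp.ne'
    have b := hs.ne'
    have c := hb.ne'
    have d := hD.ne'
    field_simp
    ring
  rw [key]
  apply div_neg_of_neg_of_pos _ (by positivity)
  have e1 := mul_lt_mul_of_pos_right h8 hD
  have e2 : pm * (sm - rp) * (sm - (1 - bp)) ≤ pm * (sm - rp) * (sp - (1 - bm)) :=
    mul_le_mul_of_nonneg_left (by linarith) (mul_nonneg hp.le (by linarith))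
  linarith
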